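/- arXiv:2305.15142 — 11 statements merged into one kernel-verified Lean document; each statement's English description precedes it below -/
import Mathlib

section
/- Let X be a nonempty finite set, p ≥ 1 a natural number, f : X → Fin p → ℝ objective functions, and M > 0 a real number with 2^(−M) ≤ f i x ≤ 2^M for all i and all x ∈ X. Let ε > 0 and set D := ⌈(2·M·log 2)/log(1+ε)⌉. Let R' be a monotonic relation on X, and suppose there is a natural number c such that every nonempty subset X' ⊆ X contains a subset P' ⊆ X' with |P'| ≤ c such that every x' ∈ X' satisfies R' x x' for some x ∈ P'. Then there exists a subset P ⊆ X with |P| ≤ c·p·D^(p−1) such that for every x' ∈ X there exists x ∈ P with R' x x' and f i x ≤ (1+ε)·f i x' for all i ∈ Fin p. -/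
/-- A geometric grid with ratio `1 + ε` on `[2 ^ (-M), 2 ^ M]`: a map to `{0, …, D - 1}`, monotone
and with fibres on which values differ by a factor of at most `1 + ε`. -/
theorem exists_geometric_grid {M ε : ℝ} (hM : 0 < M) (hε : 0 < ε) :
    ∃ k : ℝ → ℕ, ∀ y, (2 : ℝ) ^ (-M) ≤ y → y ≤ (2 : ℝ) ^ M →
      k y < ⌈(2 * M * Real.log 2) / Real.log (1 + ε)⌉₊ ∧
      ∀ z, (2 : ℝ) ^ (-M) ≤ z →
        (k y < k z → y ≤ z) ∧ (k y = k z → y ≤ (1 + ε) * z) := by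
  have hL : 0 < Real.log (1 + ε) := Real.log_pos (by linarith)
  have hlog2 : 0 < Real.log 2 := Real.log_pos (by norm_num)
  have hbase : 0 < (2 : ℝ) ^ (-M) := by positivity
  set t : ℝ → ℝ := fun y => (Real.log y + M * Real.log 2) / Real.log (1 + ε) with ht
  refine ⟨fun y => ⌈t y⌉₊ - 1, fun y hy hyM => ⟨?_, fun z hz => ⟨fun h => ?_, fun h => ?_⟩⟩⟩
  · have hle : t y ≤ (2 * M * Real.log 2) / Real.log (1 + ε) := by
      have := Real.log_le_log (hbase.trans_le hy) hyM
      rw [Real.log_rpow two_pos] at this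
      exact div_le_div_of_nonneg_right (by linarith) hL.le
    have hceil := Nat.ceil_mono hle
    have hpos : 0 < ⌈(2 * M * Real.log 2) / Real.log (1 + ε)⌉₊ := Nat.ceil_pos.2 (by positivity)
    dsimp only
    omega
  · by_contra! hlt
    have hle : t z ≤ t y :=
      div_le_div_of_nonneg_right
        (by linarith [Real.log_le_log (hbase.trans_le hz) hlt.le]) hL.le
    have hceil := Nat.ceil_mono hle
    dsimp only at h
    omega
  · have hy0 : 0 < y := hbase.trans_le hy
    have hz0 : 0 < z := hbase.trans_le hz
    have htz : 0 ≤ t z := by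
      have := Real.log_le_log hbase hz
      rw [Real.log_rpow two_pos] at this
      exact div_nonneg (by linarith) hL.le
    have hyk : t y ≤ ((⌈t y⌉₊ - 1 : ℕ) : ℝ) + 1 := by
      refine (Nat.le_ceil (t y)).trans ?_
      exact_mod_cast (by omega : ⌈t y⌉₊ ≤ ⌈t y⌉₊ - 1 + 1)
    have hzk : ((⌈t z⌉₊ - 1 : ℕ) : ℝ) ≤ t z := by
      rcases Nat.eq_zero_or_pos ⌈t z⌉₊ with h0 | h0
      · simpa [h0] using htz
      · exact (Nat.lt_ceil.1 (by omega)).le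
    dsimp only at h
    rw [h] at hyk
    have hyz : t y ≤ t z + 1 := by linarith
    rw [ht] at hyz
    dsimp only at hyz
    rw [div_add_one hL.ne', div_le_div_iff_of_pos_right hL] at hyz
    rw [← Real.log_le_log_iff hy0 (by positivity), Real.log_mul (by positivity) hz0.ne']
    linarith

/-- A set of functions `Fin p → ℕ`, each with values below `D` and vanishing somewhere, has at most
`p * D ^ (p - 1)` elements. -/
theorem card_le_of_exists_eq_zero {p D : ℕ} (S : Finset (Fin p → ℕ))
    (hlt : ∀ g ∈ S, ∀ i, g i < D) (hzero : ∀ g ∈ S, ∃ i, g i = 0) :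
    S.card ≤ p * D ^ (p - 1) := by
  classical
  cases p with
  | zero =>
    rw [Nat.zero_mul, Nat.le_zero, Finset.card_eq_zero, Finset.eq_empty_iff_forall_notMem]
    exact fun g hg => (hzero g hg).elim fun i _ => i.elim0
  | succ q =>
    let e : Fin (q + 1) × (Fin q → Fin D) → (Fin (q + 1) → ℕ) :=
      fun a => a.1.insertNth (α := fun _ => ℕ) 0 fun j => (a.2 j : ℕ)
    have hsub : S ⊆ Finset.univ.image e := by
      intro g hg
      obtain ⟨i, hi⟩ := hzero g hg
      refine Finset.mem_image.2
        ⟨(i, fun j => ⟨g (i.succAbove j), hlt g hg _⟩), Finset.mem_univ _, ?_⟩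
      have := Fin.insertNth_self_removeNth (α := fun _ => ℕ) i g
      rw [hi] at this
      exact this
    calc S.card ≤ (Finset.univ.image e).card := Finset.card_le_card hsub
      _ ≤ _ := Finset.card_image_le
      _ = (q + 1) * D ^ (q + 1 - 1) := by simp


theorem stmt_0 {X : Type*} [Fintype X] [Nonempty X] (p : ℕ) (hp : 1 ≤ p)
    (f : X → Fin p → ℝ) (hfpos : ∀ (x : X) (i : Fin p), 0 < f x i)
    (M : ℝ) (hM : 0 < M)
    (hbound : ∀ (x : X) (i : Fin p), (2 : ℝ) ^ (-M) ≤ f x i ∧ f x i ≤ (2 : ℝ) ^ M)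
    (ε : ℝ) (hε : 0 < ε)
    (D : ℕ) (hD : D = ⌈(2 * M * Real.log 2) / Real.log (1 + ε)⌉₊)
    (R' : X → X → Prop)
    (hmono : ∀ x x' : X, (∀ i, f x i ≤ f x' i) → R' x x')
    (c : ℕ)
    (hdom : ∀ X' : Finset X, X'.Nonempty →
      ∃ P' ⊆ X', P'.card ≤ c ∧ ∀ x' ∈ X', ∃ x ∈ P', R' x x') :
    ∃ P : Finset X, P.card ≤ c * p * D ^ (p - 1) ∧
      ∀ x' : X, ∃ x ∈ P, R' x x' ∧ ∀ i, f x i ≤ (1 + ε) * f x' i := by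
  classical
  obtain ⟨k, hk⟩ := exists_geometric_grid hM hε
  rw [← hD] at hk
  have : Nonempty (Fin p) := ⟨⟨0, hp⟩⟩
  let m : X → ℕ := fun x => Finset.univ.inf' Finset.univ_nonempty fun i => k (f x i)
  have hm : ∀ x i, m x ≤ k (f x i) := fun x i => Finset.inf'_le _ (Finset.mem_univ i)
  let d : X → Fin p → ℕ := fun x i => k (f x i) - m x
  have hline : ∀ x₀ : X, ∃ P : Finset X, P.card ≤ c ∧
      ∀ x', d x' = d x₀ → ∃ x ∈ P, R' x x' ∧ ∀ i, f x i ≤ (1 + ε) * f x' i := by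
    intro x₀
    -- the lowest nonempty cell on the diagonal through `x₀`
    obtain ⟨y, hy, hymin⟩ := (Finset.univ.filter fun x => d x = d x₀).exists_min_image m
      ⟨x₀, by simp⟩
    simp only [Finset.mem_filter, Finset.mem_univ, true_and] at hy hymin
    obtain ⟨P, hPsub, hPcard, hP⟩ := hdom (Finset.univ.filter fun x => d x = d x₀ ∧ m x = m y)
      ⟨y, by simp [hy]⟩
    simp only [Finset.mem_filter, Finset.mem_univ, true_and] at hP
    have hcell : ∀ x ∈ P, d x = d x₀ ∧ m x = m y := fun x hx => by simpa using hPsub hx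
    refine ⟨P, hPcard, fun x' hx' => ?_⟩
    rcases (hymin x' hx').eq_or_lt with h | h
    · obtain ⟨x, hx, hR⟩ := hP x' ⟨hx', h.symm⟩
      refine ⟨x, hx, hR, fun i => ?_⟩
      refine ((hk _ (hbound x i).1 (hbound x i).2).2 _ (hbound x' i).1).2 ?_
      have hdi : k (f x i) - m x = k (f x' i) - m x' := congrFun ((hcell x hx).1.trans hx'.symm) i
      have := (hcell x hx).2
      have := hm x i
      have := hm x' i
      omega
    · obtain ⟨x, hx, -⟩ := hP y ⟨hy, rfl⟩
      have hle : ∀ i, f x i ≤ f x' i := fun i => by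
        refine ((hk _ (hbound x i).1 (hbound x i).2).2 _ (hbound x' i).1).1 ?_
        have hdi : k (f x i) - m x = k (f x' i) - m x' :=
          congrFun ((hcell x hx).1.trans hx'.symm) i
        have := (hcell x hx).2
        have := hm x i
        have := hm x' i
        omega
      exact ⟨x, hx, hmono x x' hle, fun i => (hle i).trans <|
        le_mul_of_one_le_left (hfpos x' i).le (by linarith)⟩
  have hdiag : ∀ g ∈ Finset.univ.image d, ∃ P : Finset X, P.card ≤ c ∧
      ∀ x', d x' = g → ∃ x ∈ P, R' x x' ∧ ∀ i, f x i ≤ (1 + ε) * f x' i := by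
    intro g hg
    obtain ⟨x₀, -, rfl⟩ := Finset.mem_image.1 hg
    exact hline x₀
  choose! P hPcard hP using hdiag
  refine ⟨(Finset.univ.image d).biUnion P, ?_, fun x' => ?_⟩
  · have hcard : (Finset.univ.image d).card ≤ p * D ^ (p - 1) := by
      refine card_le_of_exists_eq_zero _ (fun g hg i => ?_) (fun g hg => ?_)
      · obtain ⟨x, -, rfl⟩ := Finset.mem_image.1 hg
        exact (Nat.sub_le _ _).trans_lt (hk _ (hbound x i).1 (hbound x i).2).1
      · obtain ⟨x, -, rfl⟩ := Finset.mem_image.1 hg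
        obtain ⟨i, -, hi⟩ := Finset.exists_mem_eq_inf' Finset.univ_nonempty fun i => k (f x i)
        exact ⟨i, Nat.sub_eq_zero_of_le hi.ge⟩
    calc _ ≤ (Finset.univ.image d).card * c := Finset.card_biUnion_le_card_mul _ _ _ hPcard
      _ ≤ p * D ^ (p - 1) * c := Nat.mul_le_mul_right c hcard
      _ = c * p * D ^ (p - 1) := by ring
  · have hmem := Finset.mem_image_of_mem d (Finset.mem_univ x')
    obtain ⟨x, hx, h⟩ := hP _ hmem x' rfl
    exact ⟨x, Finset.mem_biUnion.2 ⟨_, hmem, hx⟩, h⟩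
end

section
/- Let X be a nonempty finite set, p ≥ 1 a natural number, f : X → Fin p → ℝ objective functions, and M > 0 a real number with 2^(−M) ≤ f i x ≤ 2^M for all i and all x ∈ X. Let ε > 0 and set D := ⌈(2·M·log 2)/log(1+ε)⌉. Then there exists a (1+ε)-approximation set P ⊆ X with |P| ≤ p·D^(p−1). -/
/-- At most `p * D ^ (p - 1)` functions `Fin p → {0, …, D - 1}` vanish at some index. -/
theorem card_biUnion_piFinset_zero_le (p D : ℕ) :
    ((Finset.univ : Finset (Fin p)).biUnion fun i =>
      Fintype.piFinset fun j => if j = i then ({0} : Finset ℕ) else Finset.range D).card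
      ≤ p * D ^ (p - 1) := by
  refine (Finset.card_biUnion_le_card_mul _ _ (D ^ (p - 1)) fun i _ => ?_).trans_eq (by simp)
  rw [Fintype.card_piFinset, ← Finset.mul_prod_erase _ _ (Finset.mem_univ i),
    Finset.prod_congr rfl (g := fun _ => D)]
  · simp
  · intro j hj
    simp [Finset.ne_of_mem_erase hj]

/-- Every finite family of points in the grid `{0, …, D - 1} ^ p` contains at most
`p * D ^ (p - 1)` members such that each point of the family lies above one of them: one takes
the lowest point of the family on each diagonal. -/
theorem exists_finset_card_le_forall_exists_le {X : Type*} [Fintype X] {p D : ℕ} (hp : 1 ≤ p)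
    (k : X → Fin p → ℕ) (hk : ∀ x i, k x i < D) :
    ∃ P : Finset X, P.card ≤ p * D ^ (p - 1) ∧ ∀ x', ∃ x ∈ P, k x ≤ k x' := by
  classical
  have : Nonempty (Fin p) := ⟨⟨0, hp⟩⟩
  choose a ha using fun x => Finite.exists_min (k x)
  let d : X → Fin p → ℕ := fun x i => k x i - k x (a x)
  have lowest : ∀ x, ∃ z, d z = d x ∧ ∀ w, d w = d x → k z (a z) ≤ k w (a w) := by
    intro x
    obtain ⟨z, hz, hmin⟩ := Finset.exists_min_image (Finset.univ.filter fun z => d z = d x)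
      (fun z => k z (a z)) ⟨x, by simp⟩
    exact ⟨z, by simpa using hz, fun w hw => hmin w (by simpa using hw)⟩
  have lowest_on : ∀ t : Fin p → ℕ, (∃ x, d x = t) →
      ∃ z, d z = t ∧ ∀ w, d w = t → k z (a z) ≤ k w (a w) := by
    rintro _ ⟨x, rfl⟩
    exact lowest x
  rcases isEmpty_or_nonempty X with hX | hX
  · exact ⟨∅, by simp, fun x => hX.elim x⟩
  choose! r hr hrmin using lowest_on
  refine ⟨(Finset.univ.image d).image r, ?_, fun x' => ⟨r (d x'), by simp, fun i => ?_⟩⟩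
  · refine Finset.card_image_le.trans
      ((Finset.card_le_card ?_).trans (card_biUnion_piFinset_zero_le p D))
    intro t ht
    obtain ⟨x, -, rfl⟩ := Finset.mem_image.1 ht
    refine Finset.mem_biUnion.2 ⟨a x, Finset.mem_univ _, Fintype.mem_piFinset.2 fun j => ?_⟩
    by_cases hj : j = a x
    · simp [d, hj]
    · simpa [hj] using (Nat.sub_le _ _).trans_lt (hk x j)
  · have h₁ : k (r (d x')) i - k (r (d x')) (a (r (d x'))) = k x' i - k x' (a x') :=
      congrFun (hr (d x') ⟨x', rfl⟩) i
    have h₂ := hrmin (d x') ⟨x', rfl⟩ x' rfl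
    have h₃ := ha x' i
    have h₄ := ha (r (d x')) i
    change k (r (d x')) i ≤ k x' i
    omega

theorem stmt_1 {X : Type*} [Fintype X] [Nonempty X] (p : ℕ) (hp : 1 ≤ p)
    (f : X → Fin p → ℝ) (hfpos : ∀ (x : X) (i : Fin p), 0 < f x i)
    (M : ℝ) (hM : 0 < M)
    (hbound : ∀ (x : X) (i : Fin p), (2 : ℝ) ^ (-M) ≤ f x i ∧ f x i ≤ (2 : ℝ) ^ M)
    (ε : ℝ) (hε : 0 < ε)
    (D : ℕ) (hD : D = ⌈(2 * M * Real.log 2) / Real.log (1 + ε)⌉₊) :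
    ∃ P : Finset X, P.card ≤ p * D ^ (p - 1) ∧
      ∀ x' : X, ∃ x ∈ P, ∀ i, f x i ≤ (1 + ε) * f x' i := by
  have hlog : 0 < Real.log (1 + ε) := Real.log_pos (by linarith)
  have hD_pos : 0 < D := by
    rw [hD, Nat.ceil_pos]
    have := Real.log_pos one_lt_two
    positivity
  let y : X → Fin p → ℝ := fun x i => (Real.log (f x i) + M * Real.log 2) / Real.log (1 + ε)
  have hy_nonneg : ∀ x i, 0 ≤ y x i := by
    intro x i
    have h := Real.log_le_log (by positivity) (hbound x i).1
    rw [Real.log_rpow two_pos] at h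
    exact div_nonneg (by linarith) hlog.le
  have hy_ceil : ∀ x i, ⌈y x i⌉₊ ≤ D := by
    intro x i
    have h := Real.log_le_log (hfpos x i) (hbound x i).2
    rw [Real.log_rpow two_pos] at h
    rw [hD]
    exact Nat.ceil_mono (div_le_div_of_nonneg_right (by linarith) hlog.le)
  obtain ⟨P, hcard, hP⟩ := exists_finset_card_le_forall_exists_le hp
    (fun x i => ⌈y x i⌉₊ - 1) (D := D) (fun x i => by have := hy_ceil x i; omega)
  refine ⟨P, hcard, fun x' => ?_⟩
  obtain ⟨x, hx, hle⟩ := hP x'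
  refine ⟨x, hx, fun i => ?_⟩
  have hxx' : ⌈y x i⌉₊ - 1 ≤ ⌈y x' i⌉₊ - 1 := hle i
  have hy : y x i ≤ y x' i + 1 := by
    rcases Nat.eq_zero_or_pos ⌈y x' i⌉₊ with h0 | h0
    · have h : (⌈y x i⌉₊ : ℝ) ≤ 1 := by
        exact_mod_cast (by omega : ⌈y x i⌉₊ ≤ 1)
      linarith [Nat.le_ceil (y x i), hy_nonneg x' i]
    · have h : (⌈y x i⌉₊ : ℝ) ≤ ⌈y x' i⌉₊ := by
        exact_mod_cast (by omega : ⌈y x i⌉₊ ≤ ⌈y x' i⌉₊)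
      linarith [Nat.le_ceil (y x i), Nat.ceil_lt_add_one (hy_nonneg x' i)]
  have hfx' := hfpos x' i
  rw [← Real.log_le_log_iff (hfpos x i) (by positivity),
    Real.log_mul (by positivity) hfx'.ne']
  simp only [y] at hy
  rw [div_add_one hlog.ne', div_le_div_iff_of_pos_right hlog] at hy
  linarith
end

section
/- Let X be a nonempty finite set, p ≥ 1 a natural number, f : X → Fin p → ℝ objective functions, and M > 0 a real number with 2^(−M) ≤ f i x ≤ 2^M for all i and all x ∈ X. Let ε > 0 and set D := ⌈(2·M·log 2)/log(1+ε)⌉. Then there exists a one-exact (1+ε)-approximation set P ⊆ X with |P| ≤ p·D^(p−1). -/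
theorem exists_finset_card_le_fiberwise_le {X Y : Type*} [Fintype X] [Nonempty X] [Fintype Y]
    (g : X → Y) (h : X → ℝ) :
    ∃ P : Finset X, P.card ≤ Fintype.card Y ∧
      ∀ x' : X, ∃ x ∈ P, g x = g x' ∧ h x ≤ h x' := by
  classical
  have hmin : ∀ y : Y, ∃ x : X, ∀ x' : X, g x' = y → g x = y ∧ h x ≤ h x' := by
    intro y
    by_cases hy : (Finset.univ.filter fun x => g x = y).Nonempty
    · obtain ⟨x, hx, hle⟩ := Finset.exists_min_image _ h hy
      exact ⟨x, fun x' hx' => ⟨by simpa using hx, hle x' (by simpa using hx')⟩⟩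
    · exact ⟨Classical.arbitrary X, fun x' hx' => (hy ⟨x', by simpa using hx'⟩).elim⟩
  choose c hc using hmin
  exact ⟨Finset.univ.image c, Finset.card_image_le, fun x' =>
    ⟨c (g x'), Finset.mem_image_of_mem c (Finset.mem_univ _), hc (g x') x' rfl⟩⟩

theorem exists_fin_le_and_le_add_one {D : ℕ} (hD : 0 < D) {y : ℝ} (h0 : 0 ≤ y) (hy : y ≤ D) :
    ∃ k : Fin D, (k : ℝ) ≤ y ∧ y ≤ k + 1 := by
  have hle : ⌈y⌉₊ ≤ D := Nat.ceil_le.mpr hy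
  refine ⟨⟨⌈y⌉₊ - 1, by omega⟩, ?_, ?_⟩
  · rcases Nat.eq_zero_or_pos ⌈y⌉₊ with h | h
    · simpa [h] using h0
    · have := Nat.ceil_lt_add_one h0
      simp only [Nat.cast_pred h]
      linarith
  · refine (Nat.le_ceil y).trans ?_
    exact_mod_cast (by omega : ⌈y⌉₊ ≤ ⌈y⌉₊ - 1 + 1)

theorem stmt_2 {X : Type*} [Fintype X] [Nonempty X] (p : ℕ) (hp : 1 ≤ p)
    (f : X → Fin p → ℝ) (hfpos : ∀ (x : X) (i : Fin p), 0 < f x i)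
    (M : ℝ) (hM : 0 < M)
    (hbound : ∀ (x : X) (i : Fin p), (2 : ℝ) ^ (-M) ≤ f x i ∧ f x i ≤ (2 : ℝ) ^ M)
    (ε : ℝ) (hε : 0 < ε)
    (D : ℕ) (hD : D = ⌈(2 * M * Real.log 2) / Real.log (1 + ε)⌉₊) :
    ∃ P : Finset X, P.card ≤ p * D ^ (p - 1) ∧
      ∀ x' : X, ∃ x ∈ P, f x ⟨0, by omega⟩ ≤ f x' ⟨0, by omega⟩ ∧
        ∀ i, f x i ≤ (1 + ε) * f x' i := by
  obtain ⟨q, rfl⟩ : ∃ q, p = q + 1 := ⟨p - 1, by omega⟩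
  have hL : 0 < Real.log (1 + ε) := Real.log_pos (by linarith)
  have hlog2 : 0 < Real.log 2 := Real.log_pos (by norm_num)
  have hDpos : 0 < D := hD ▸ Nat.ceil_pos.mpr (by positivity)
  have hcell : ∀ (x : X) (i : Fin q), ∃ k : Fin D,
      (k : ℝ) ≤ (Real.log (f x i.succ) + M * Real.log 2) / Real.log (1 + ε) ∧
      (Real.log (f x i.succ) + M * Real.log 2) / Real.log (1 + ε) ≤ k + 1 := by
    intro x i
    obtain ⟨hlo, hhi⟩ := hbound x i.succ
    have hlo' := Real.log_le_log (by positivity) hlo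
    have hhi' := Real.log_le_log (hfpos x i.succ) hhi
    rw [Real.log_rpow two_pos] at hlo' hhi'
    refine exists_fin_le_and_le_add_one hDpos (div_nonneg (by linarith) hL.le) ?_
    calc _ ≤ (2 * M * Real.log 2) / Real.log (1 + ε) := by gcongr; linarith
      _ ≤ D := hD ▸ Nat.le_ceil _
  choose g hg using hcell
  obtain ⟨P, hcard, hP⟩ := exists_finset_card_le_fiberwise_le g fun x => f x 0
  refine ⟨P, ?_, fun x' => ?_⟩
  · simp only [Fintype.card_fun, Fintype.card_fin] at hcard
    simpa using hcard.trans (Nat.le_mul_of_pos_left _ q.succ_pos)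
  · obtain ⟨x, hxP, hgx, hx0⟩ := hP x'
    refine ⟨x, hxP, hx0, Fin.cases ?_ fun i => ?_⟩
    · nlinarith [hfpos x' 0]
    · have h1 := (hg x i).2
      have h2 := (hg x' i).1
      rw [← hgx] at h2
      have h3 := h1.trans (add_le_add_left h2 1)
      rw [div_add_one hL.ne', div_le_div_iff_of_pos_right hL] at h3
      rw [← Real.log_le_log_iff (hfpos _ _) (mul_pos (by linarith) (hfpos _ _)),
        Real.log_mul (by linarith) (hfpos _ _).ne']
      linarith
end

section
/- Let k ≥ 1 and p be natural numbers with k ≤ ⌈p/2⌉, and let c be a natural number such that the following tournament-domination property holds: for every finite type V and every family of 2k−1 linear orders ≤₁,…,≤_{2k−1} on V, there exists a subset S ⊆ V with |S| ≤ c such that for every v ∈ V there exists u ∈ S with u ≤_j v in at least k of the orders. Let X be a nonempty finite set, f : X → Fin p → ℝ, and M > 0 with 2^(−M) ≤ f i x ≤ 2^M for all i and x. Let ε > 0 and set D := ⌈(2·M·log 2)/log(1+ε)⌉. Then there exists a quasi-k-exact (1+ε)-approximation set P ⊆ X with |P| ≤ c·p·D^(p−1). -/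
/-- A relation-level tournament domination hypothesis yields, for real-valued objectives (possibly
with ties), a small subset of any finset that is majority-dominating. -/
lemma exists_majority_dominating {k n p c : ℕ} (hnp : n ≤ p)
    (htour : ∀ (V : Type) [Fintype V] (r : Fin n → V → V → Prop),
      (∀ j, IsLinearOrder V (r j)) →
      ∃ S : Finset V, S.card ≤ c ∧ ∀ v : V, ∃ u ∈ S, k ≤ {j : Fin n | r j u v}.ncard)
    {X : Type*} [Fintype X] (f : X → Fin p → ℝ) (B : Finset X) :
    ∃ S ⊆ B, S.card ≤ c ∧ ∀ v ∈ B, ∃ u ∈ S, k ≤ {i : Fin p | f u i ≤ f v i}.ncard := by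
  classical
  let e := B.equivFin
  let g : Fin n → Fin B.card → ℝ ×ₗ Fin B.card :=
    fun j u ↦ toLex (f (e.symm u) (Fin.castLE hnp j), u)
  have hg : ∀ j, Function.Injective (g j) := fun j u v h ↦ congrArg (fun q ↦ (ofLex q).2) h
  obtain ⟨S, hSc, hS⟩ := htour (Fin B.card) (fun j u v ↦ g j u ≤ g j v) fun j ↦
    { refl := fun u ↦ le_refl (g j u)
      trans := fun u v w ↦ le_trans (a := g j u)
      antisymm := fun u v h h' ↦ hg j (le_antisymm h h')
      total := fun u v ↦ le_total (g j u) (g j v) }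
  refine ⟨S.image fun u ↦ (e.symm u : X), ?_, Finset.card_image_le.trans hSc, fun v hv ↦ ?_⟩
  · intro x hx
    obtain ⟨u, -, rfl⟩ := Finset.mem_image.1 hx
    exact (e.symm u).2
  · obtain ⟨u, hu, hk⟩ := hS (e ⟨v, hv⟩)
    refine ⟨_, Finset.mem_image_of_mem _ hu, hk.trans ?_⟩
    refine Set.ncard_le_ncard_of_injOn (Fin.castLE hnp) (fun j hj ↦ ?_)
      (Fin.castLE_injective hnp).injOn (Set.toFinite _)
    have h := Prod.Lex.monotone_fst _ _ (show g j u ≤ g j (e ⟨v, hv⟩) from hj)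
    simpa [g] using h

/-- There are at most `p * D ^ (p - 1)` points of the grid `{0, …, D - 1}ᵖ` having a zero
coordinate. -/
lemma card_le_of_exists_coord_eq_zero {p D : ℕ} (K : Finset (Fin p → ℕ))
    (hlt : ∀ d ∈ K, ∀ i, d i < D) (hzero : ∀ d ∈ K, ∃ i, d i = 0) :
    K.card ≤ p * D ^ (p - 1) := by
  classical
  let face : Fin p → Finset (Fin p → ℕ) := fun i ↦
    Fintype.piFinset (Function.update (fun _ ↦ Finset.range D) i {0})
  have hface : ∀ i, (face i).card = D ^ (p - 1) := by
    intro i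
    rw [Fintype.card_piFinset, ← Finset.mul_prod_erase _ _ (Finset.mem_univ i),
      Finset.prod_congr rfl (g := fun _ ↦ D)]
    · simp
    · intro j hj
      simp [Finset.ne_of_mem_erase hj]
  have hsub : K ⊆ Finset.univ.biUnion face := by
    intro d hd
    obtain ⟨i, hi⟩ := hzero d hd
    refine Finset.mem_biUnion.2 ⟨i, Finset.mem_univ i, Fintype.mem_piFinset.2 fun j ↦ ?_⟩
    by_cases hj : j = i
    · subst hj; simp [hi]
    · simp [hj, hlt d hd j]
  calc K.card ≤ (Finset.univ.biUnion face).card := Finset.card_le_card hsub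
    _ ≤ (Finset.univ : Finset (Fin p)).card * D ^ (p - 1) :=
      Finset.card_biUnion_le_card_mul _ _ _ fun i _ ↦ (hface i).le
    _ = p * D ^ (p - 1) := by simp

/-- Choosing, on every diagonal of a grid, representatives of the lowest occupied cell only. -/
lemma exists_finset_of_grid {p D c : ℕ} (hp : 0 < p) {X : Type*} [Fintype X]
    [Nonempty X]
    (a : X → Fin p → ℕ) (ha : ∀ x i, a x i < D) (R : X → X → Prop)
    (hlt : ∀ x y, (∀ i, a x i < a y i) → R x y)
    (hcell : ∀ b : Fin p → ℕ, ∃ S : Finset X, S.card ≤ c ∧ (∀ x ∈ S, a x = b) ∧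
      ∀ y, a y = b → ∃ x ∈ S, R x y) :
    ∃ P : Finset X, P.card ≤ c * p * D ^ (p - 1) ∧ ∀ y, ∃ x ∈ P, R x y := by
  classical
  have : Nonempty (Fin p) := ⟨⟨0, hp⟩⟩
  choose i₀ hi₀ using fun x ↦ Finite.exists_min (a x)
  choose S hSc hSa hSR using hcell
  let key : X → Fin p → ℕ := fun x i ↦ a x i - a x (i₀ x)
  have hlow : ∀ d ∈ Finset.univ.image key, ∃ x, key x = d ∧
      ∀ y, key y = d → a x (i₀ x) ≤ a y (i₀ y) := by
    intro d hd
    obtain ⟨z, -, hz⟩ := Finset.mem_image.1 hd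
    obtain ⟨x, hx, hmin⟩ := (Finset.univ.filter fun x ↦ key x = d).exists_min_image
      (fun x ↦ a x (i₀ x)) ⟨z, by simp [hz]⟩
    exact ⟨x, by simpa using hx, fun y hy ↦ hmin y (by simp [hy])⟩
  choose! low hlow_key hlow_min using hlow
  refine ⟨(Finset.univ.image key).biUnion fun d ↦ S (a (low d)), ?_, fun y ↦ ?_⟩
  · calc _ ≤ (Finset.univ.image key).card * c :=
          Finset.card_biUnion_le_card_mul _ _ _ fun d _ ↦ hSc _
      _ ≤ p * D ^ (p - 1) * c := by
          refine Nat.mul_le_mul_right c (card_le_of_exists_coord_eq_zero _ ?_ ?_)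
          · intro d hd i
            obtain ⟨z, -, rfl⟩ := Finset.mem_image.1 hd
            exact (Nat.sub_le _ _).trans_lt (ha z i)
          · intro d hd
            obtain ⟨z, -, rfl⟩ := Finset.mem_image.1 hd
            exact ⟨i₀ z, Nat.sub_self _⟩
      _ = c * p * D ^ (p - 1) := by ring
  · have hd : key y ∈ Finset.univ.image key := Finset.mem_image_of_mem _ (Finset.mem_univ y)
    let w := low (key y)
    have hkey : ∀ i, a w i - a w (i₀ w) = a y i - a y (i₀ y) := congrFun (hlow_key _ hd)
    have hmin : a w (i₀ w) ≤ a y (i₀ y) := hlow_min _ hd y rfl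
    suffices ∃ x ∈ S (a w), R x y by
      obtain ⟨x, hx, hR⟩ := this
      exact ⟨x, Finset.mem_biUnion.2 ⟨_, hd, hx⟩, hR⟩
    rcases hmin.eq_or_lt with h | h
    · refine hSR _ y (funext fun i ↦ ?_)
      have := hkey i; have := hi₀ w i; have := hi₀ y i
      omega
    · obtain ⟨x, hx, -⟩ := hSR (a w) w rfl
      refine ⟨x, hx, hlt x y fun i ↦ ?_⟩
      rw [hSa _ x hx]
      have := hkey i; have := hi₀ w i; have := hi₀ y i
      omega

theorem stmt_3 (k p : ℕ) (hk : 1 ≤ k) (hkp : k ≤ (p + 1) / 2)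
    (c : ℕ)
    (htour : ∀ (V : Type) [Fintype V] (r : Fin (2 * k - 1) → V → V → Prop),
      (∀ j, IsLinearOrder V (r j)) →
      ∃ S : Finset V, S.card ≤ c ∧
        ∀ v : V, ∃ u ∈ S, k ≤ {j : Fin (2 * k - 1) | r j u v}.ncard)
    {X : Type*} [Fintype X] [Nonempty X]
    (f : X → Fin p → ℝ) (hfpos : ∀ (x : X) (i : Fin p), 0 < f x i)
    (M : ℝ) (hM : 0 < M)
    (hbound : ∀ (x : X) (i : Fin p), (2 : ℝ) ^ (-M) ≤ f x i ∧ f x i ≤ (2 : ℝ) ^ M)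
    (ε : ℝ) (hε : 0 < ε)
    (D : ℕ) (hD : D = ⌈(2 * M * Real.log 2) / Real.log (1 + ε)⌉₊) :
    ∃ P : Finset X, P.card ≤ c * p * D ^ (p - 1) ∧
      ∀ x' : X, ∃ x ∈ P, (∀ i, f x i ≤ (1 + ε) * f x' i) ∧
        k ≤ {i : Fin p | f x i ≤ f x' i}.ncard := by
  classical
  have hL : 0 < Real.log (1 + ε) := Real.log_pos (by linarith)
  have hl2 : 0 < Real.log 2 := Real.log_pos (by norm_num)
  let t : X → Fin p → ℝ := fun x i ↦ (Real.log (f x i) + M * Real.log 2) / Real.log (1 + ε)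
  have htD : ∀ x i, t x i ≤ D := by
    intro x i
    have h := Real.log_le_log (hfpos x i) (hbound x i).2
    rw [Real.log_rpow two_pos] at h
    rw [hD]
    refine le_trans ?_ (Nat.le_ceil _)
    exact div_le_div_of_nonneg_right (by linarith) hL.le
  have ht0 : ∀ x i, 0 ≤ t x i := by
    intro x i
    have h := Real.log_le_log (by positivity) (hbound x i).1
    rw [Real.log_rpow two_pos] at h
    exact div_nonneg (by linarith) hL.le
  have hD0 : 0 < D := hD ▸ Nat.ceil_pos.2 (by positivity)
  have htf : ∀ x y i, t x i ≤ t y i → f x i ≤ f y i := by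
    intro x y i h
    rw [div_le_div_iff_of_pos_right hL, add_le_add_iff_right] at h
    exact (Real.log_le_log_iff (hfpos x i) (hfpos y i)).1 h
  have htf' : ∀ x y i, t x i ≤ t y i + 1 → f x i ≤ (1 + ε) * f y i := by
    intro x y i h
    rw [div_add_one hL.ne', div_le_div_iff_of_pos_right hL] at h
    rw [← Real.log_le_log_iff (hfpos x i) (mul_pos (by linarith) (hfpos y i)),
      Real.log_mul (by linarith) (hfpos y i).ne']
    linarith
  refine exists_finset_of_grid (by omega) (fun x i ↦ ⌈t x i⌉₊ - 1) ?_ _ ?_ ?_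
  · intro x i
    have := Nat.ceil_le.2 (htD x i)
    omega
  · intro x y h
    have hle : ∀ i, f x i ≤ f y i := fun i ↦ by
      have hi : ⌈t x i⌉₊ < ⌈t y i⌉₊ := by have := h i; omega
      exact htf x y i ((Nat.le_ceil _).trans (Nat.lt_ceil.1 hi).le)
    refine ⟨fun i ↦ (hle i).trans (le_mul_of_one_le_left (hfpos y i).le (by linarith)), ?_⟩
    simp only [hle, Set.ofPred_true, Set.ncard_univ, Nat.card_fin]
    omega
  · intro b
    obtain ⟨S, hSB, hSc, hS⟩ := exists_majority_dominating (by omega) htour f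
      (Finset.univ.filter fun x ↦ (fun i ↦ ⌈t x i⌉₊ - 1) = b)
    have hSb : ∀ x ∈ S, (fun i ↦ ⌈t x i⌉₊ - 1) = b := fun x hx ↦ by simpa using hSB hx
    refine ⟨S, hSc, hSb, fun y hy ↦ ?_⟩
    obtain ⟨x, hx, hxk⟩ := hS y (by simpa using hy)
    refine ⟨x, hx, fun i ↦ htf' x y i ?_, hxk⟩
    have hi : ⌈t x i⌉₊ - 1 = ⌈t y i⌉₊ - 1 := congrFun ((hSb x hx).trans hy.symm) i
    have hle : ⌈t x i⌉₊ ≤ ⌈t y i⌉₊ ∨ ⌈t x i⌉₊ ≤ 1 := by omega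
    rcases hle with h | h
    · exact (Nat.le_ceil _).trans ((Nat.cast_le.2 h).trans (Nat.ceil_lt_add_one (ht0 y i)).le)
    · have := Nat.ceil_le.1 h
      push_cast at this
      linarith [ht0 y i]
end

section
/- Let p ≥ 2 be a natural number, X a nonempty finite set, and g : X → Fin 2 → ℝ a biobjective instance with g j x > 0 for all j and x. Define f : X → Fin p → ℝ by f 0 x = g 0 x and f i x = g 1 x for all i ≥ 1. Let ε > 0 and let P ⊆ X be a one-exact, quasi-2-exact (1+ε)-approximation set for (X, f). Then for every solution x' ∈ X that is efficient with respect to g, there exists x ∈ P with g 0 x = g 0 x' and g 1 x = g 1 x'. In particular, the cardinality of P is at least the number of nondominated points of (X, g). -/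
/-- `x` dominates `x'` in the biobjective instance `g`. -/
def BiDominates {X : Type*} (g : X → Fin 2 → ℝ) (x x' : X) : Prop :=
  (∀ j, g x j ≤ g x' j) ∧ ∃ j, g x j < g x' j

/-- `x` is efficient in the biobjective instance `g`. -/
def BiEfficient {X : Type*} (g : X → Fin 2 → ℝ) (x : X) : Prop :=
  ¬ ∃ x'' : X, BiDominates g x'' x

/-- A weakly dominated efficient solution has the same image as the solution weakly dominating it. -/
theorem BiEfficient.eq_of_le {X : Type*} {g : X → Fin 2 → ℝ} {x x' : X}
    (hx' : BiEfficient g x') (hle : ∀ j, g x j ≤ g x' j) : g x = g x' := by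
  by_contra hne
  obtain ⟨j, hj⟩ := Function.ne_iff.mp hne
  exact hx' ⟨x, hle, j, (hle j).lt_of_ne hj⟩

theorem stmt_4 {X : Type*} [Fintype X] [Nonempty X] (p : ℕ) (hp : 2 ≤ p)
    (g : X → Fin 2 → ℝ) (hgpos : ∀ (x : X) (j : Fin 2), 0 < g x j)
    (f : X → Fin p → ℝ)
    (hf : ∀ (x : X) (i : Fin p), f x i = if (i : ℕ) = 0 then g x 0 else g x 1)
    (ε : ℝ) (hε : 0 < ε)
    (P : Finset X)
    (hP : ∀ x' : X, ∃ x ∈ P, f x ⟨0, by omega⟩ ≤ f x' ⟨0, by omega⟩ ∧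
      (∀ i, f x i ≤ (1 + ε) * f x' i) ∧
      ∃ i : Fin p, (i : ℕ) ≠ 0 ∧ f x i ≤ f x' i) :
    (∀ x' : X, BiEfficient g x' →
      ∃ x ∈ P, g x 0 = g x' 0 ∧ g x 1 = g x' 1) ∧
    (g '' {x : X | BiEfficient g x}).ncard ≤ P.card := by
  have key : ∀ x' : X, BiEfficient g x' → ∃ x ∈ P, g x = g x' := by
    intro x' hx'
    obtain ⟨x, hxP, h0, -, i, hi, h1⟩ := hP x'
    simp only [hf, if_true] at h0
    simp only [hf, if_neg hi] at h1
    exact ⟨x, hxP, hx'.eq_of_le (Fin.forall_fin_two.mpr ⟨h0, h1⟩)⟩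
  refine ⟨fun x' hx' => ?_, ?_⟩
  · obtain ⟨x, hxP, hx⟩ := key x' hx'
    exact ⟨x, hxP, by rw [hx], by rw [hx]⟩
  · have hsub : g '' {x : X | BiEfficient g x} ⊆ g '' (P : Set X) := by
      rintro _ ⟨x', hx', rfl⟩
      exact key x' hx'
    calc (g '' {x : X | BiEfficient g x}).ncard
        ≤ (g '' (P : Set X)).ncard := Set.ncard_le_ncard hsub (P.finite_toSet.image g)
      _ ≤ (P : Set X).ncard := Set.ncard_image_le P.finite_toSet
      _ = P.card := Set.ncard_coe_finset P
end

section
/- Let ε > 0 and consider the biobjective instance with X = Fin 6 and f : X → Fin 2 → ℝ given by f(x¹) = (1, (1+ε)²), f(x²) = (1+ε/2, (1+ε)(1+ε/4)), f(x³) = ((1+ε)(1+ε/4), 1+ε/2), f(x⁴) = ((1+ε)², 1), f(x⁵) = (1+ε, (1+ε)(1+ε/2)), f(x⁶) = ((1+ε)(1+ε/2), 1+ε). Then: (i) x⁵ is strictly dominated by x² and x⁶ is strictly dominated by x³; (ii) no single solution (1+ε)-dominates all six solutions, so every quasi-1-exact (1+ε)-approximation set has cardinality at least 2; and (iii) the set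 {x⁵, x⁶} is a quasi-1-exact (1+ε)-approximation set. Hence {x⁵, x⁶} is a minimum-cardinality quasi-1-exact (1+ε)-approximation set consisting of strictly dominated solutions only. -/
theorem stmt_6 (ε : ℝ) (hε : 0 < ε) (f : Fin 6 → Fin 2 → ℝ)
    (hf : f = ![![1, (1 + ε) ^ 2],
                ![1 + ε / 2, (1 + ε) * (1 + ε / 4)],
                ![(1 + ε) * (1 + ε / 4), 1 + ε / 2],
                ![(1 + ε) ^ 2, 1],
                ![1 + ε, (1 + ε) * (1 + ε / 2)],
                ![(1 + ε) * (1 + ε / 2), 1 + ε]]) :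
    -- (i) x⁵ is strictly dominated by x², and x⁶ is strictly dominated by x³
    (∀ j, f 1 j < f 4 j) ∧ (∀ j, f 2 j < f 5 j) ∧
    -- (ii) no single solution (1+ε)-dominates all six solutions ...
    (¬ ∃ x : Fin 6, ∀ (x' : Fin 6) (j : Fin 2), f x j ≤ (1 + ε) * f x' j) ∧
    (∀ P : Finset (Fin 6),
      (∀ x' : Fin 6, ∃ x ∈ P, (∀ j, f x j ≤ (1 + ε) * f x' j) ∧ ∃ j, f x j ≤ f x' j) →
      2 ≤ P.card) ∧
    -- (iii) {x⁵, x⁶} is a quasi-1-exact (1+ε)-approximation set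
    (∀ x' : Fin 6, ∃ x ∈ ({4, 5} : Finset (Fin 6)),
      (∀ j, f x j ≤ (1 + ε) * f x' j) ∧ ∃ j, f x j ≤ f x' j) := by
  have hsq : 0 < ε ^ 2 := by positivity
  have no_single : ¬ ∃ x : Fin 6, ∀ (x' : Fin 6) (j : Fin 2), f x j ≤ (1 + ε) * f x' j := by
    rintro ⟨x, hx⟩
    have h0 := hx 0 0
    have h1 := hx 3 1
    clear hx
    subst hf
    fin_cases x <;> simp at h0 h1 <;> nlinarith
  refine ⟨?_, ?_, no_single, ?_, ?_⟩
  · intro j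
    subst hf
    fin_cases j <;> simp <;> nlinarith
  · intro j
    subst hf
    fin_cases j <;> simp <;> nlinarith
  · intro P hP
    by_contra! hcard
    have hsub := Finset.card_le_one.mp (Nat.le_of_lt_succ hcard)
    obtain ⟨x, hx, -⟩ := hP 0
    refine no_single ⟨x, fun x' => ?_⟩
    obtain ⟨y, hy, hdom, -⟩ := hP x'
    rwa [hsub x hx y hy]
  · have covers (a x' : Fin 6) (k : Fin 2) (ha : a ∈ ({4, 5} : Finset (Fin 6)))
        (h0 : f a 0 ≤ (1 + ε) * f x' 0) (h1 : f a 1 ≤ (1 + ε) * f x' 1)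
        (hk : f a k ≤ f x' k) :
        ∃ x ∈ ({4, 5} : Finset (Fin 6)),
          (∀ j, f x j ≤ (1 + ε) * f x' j) ∧ ∃ j, f x j ≤ f x' j :=
      ⟨a, ha, Fin.forall_fin_two.mpr ⟨h0, h1⟩, k, hk⟩
    subst hf
    intro x'
    fin_cases x'
    · apply covers 4 0 1 <;> simp <;> nlinarith
    · apply covers 5 1 1 <;> simp <;> nlinarith
    · apply covers 4 2 0 <;> simp <;> nlinarith
    · apply covers 5 3 0 <;> simp <;> nlinarith
    · apply covers 4 4 0 <;> simp <;> nlinarith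
    · apply covers 5 5 0 <;> simp <;> nlinarith
end

section
/- Let ε > 0, let n ≥ 1 be a natural number, and set δ := (1+ε)^(1/(2n)) − 1, so that (1+δ)^(2n) = 1+ε. Consider the biobjective instance whose feasible set consists of the 3n+1 solutions x⁰, x¹,…,xⁿ, x̄¹,…,x̄ⁿ, x̃¹,…,x̃ⁿ with objective values f(x⁰) = (1, (1+ε)ⁿ), f(xⁱ) = (3i+1, (1+ε)^(n−i)·(1+δ)ⁱ), f(x̄ⁱ) = (3i, (1+ε)^(n−i)·(1+δ)^(i−1)), f(x̃ⁱ) = (3i+2, (1+ε)^(n−i)/(1+δ)ⁱ) for i = 1,…,n. Then: (i) the set {x⁰, x¹, …, xⁿ} is a one-exact (1+ε)-approximation set of cardinality n+1; (ii) every one-exact (1+ε)-approximation set has cardinality at least n+1; (iii) x⁰ is not strictly dominated by any solution; and (iv) for each i ∈ {1,…,n}, xⁱ is strictly dominated by x̄ⁱ. Hence {x⁰, x¹, …, xⁿ} is a minimum-cardinality one-exact (1+ε)-approximation set in which all solutions except x⁰ are strictly dominated. -/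
/-- The feasible set of the instance: `x⁰` together with `x¹,…,xⁿ`, `x̄¹,…,x̄ⁿ`, `x̃¹,…,x̃ⁿ`
(an element `i : Fin n` represents the index `i+1 ∈ {1,…,n}`). -/
abbrev XSpace (n : ℕ) := Unit ⊕ Fin n ⊕ Fin n ⊕ Fin n

/-- `x⁰`. -/
abbrev x0 (n : ℕ) : XSpace n := Sum.inl ()
/-- `xⁱ⁺¹`. -/
abbrev xP (n : ℕ) (i : Fin n) : XSpace n := Sum.inr (Sum.inl i)
/-- `x̄ⁱ⁺¹`. -/
abbrev xB (n : ℕ) (i : Fin n) : XSpace n := Sum.inr (Sum.inr (Sum.inl i))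
/-- `x̃ⁱ⁺¹`. -/
abbrev xT (n : ℕ) (i : Fin n) : XSpace n := Sum.inr (Sum.inr (Sum.inr i))

/-- The objective functions of the instance. -/
noncomputable def objf (n : ℕ) (ε δ : ℝ) : XSpace n → Fin 2 → ℝ
  | Sum.inl _ => ![1, (1 + ε) ^ n]
  | Sum.inr (Sum.inl i) =>
      ![((3 * ((i : ℕ) + 1) + 1 : ℕ) : ℝ),
        (1 + ε) ^ (n - ((i : ℕ) + 1)) * (1 + δ) ^ ((i : ℕ) + 1)]
  | Sum.inr (Sum.inr (Sum.inl i)) =>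
      ![((3 * ((i : ℕ) + 1) : ℕ) : ℝ),
        (1 + ε) ^ (n - ((i : ℕ) + 1)) * (1 + δ) ^ (i : ℕ)]
  | Sum.inr (Sum.inr (Sum.inr i)) =>
      ![((3 * ((i : ℕ) + 1) + 2 : ℕ) : ℝ),
        (1 + ε) ^ (n - ((i : ℕ) + 1)) / (1 + δ) ^ ((i : ℕ) + 1)]

/-- `P` is a one-exact `(1+ε)`-approximation set for the instance. -/
def OneExactApproxSet (n : ℕ) (ε δ : ℝ) (P : Finset (XSpace n)) : Prop :=
  ∀ x' : XSpace n, ∃ x ∈ P,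
    objf n ε δ x 0 ≤ objf n ε δ x' 0 ∧ objf n ε δ x 1 ≤ (1 + ε) * objf n ε δ x' 1

/-- The superscript of a solution. -/
def solIndex (n : ℕ) : XSpace n → ℕ
  | Sum.inl _ => 0
  | Sum.inr (Sum.inl i) => i + 1
  | Sum.inr (Sum.inr (Sum.inl i)) => i + 1
  | Sum.inr (Sum.inr (Sum.inr i)) => i + 1

/-- The second objective of a solution, as an exponent of `1 + δ`. -/
def objExponent (n : ℕ) : XSpace n → ℤ
  | Sum.inl _ => 2 * n * n
  | Sum.inr (Sum.inl i) => 2 * n * (n - (i + 1)) + (i + 1)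
  | Sum.inr (Sum.inr (Sum.inl i)) => 2 * n * (n - (i + 1)) + i
  | Sum.inr (Sum.inr (Sum.inr i)) => 2 * n * (n - (i + 1)) - (i + 1)

theorem objf_one_eq_zpow {n : ℕ} {ε δ : ℝ} (h0 : 0 < 1 + δ) (hr : (1 + δ) ^ (2 * n) = 1 + ε)
    (x : XSpace n) : objf n ε δ x 1 = (1 + δ) ^ objExponent n x := by
  have hpow (m : ℕ) : (1 + ε) ^ m = (1 + δ) ^ (2 * n * m : ℤ) := by
    rw [← hr, ← pow_mul, ← zpow_natCast]
    push_cast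
    rfl
  have hcast (i : Fin n) : ((n - ((i : ℕ) + 1) : ℕ) : ℤ) = n - (i + 1) := by
    have := i.isLt
    omega
  rcases x with _ | i | i | i
  · simp [objf, objExponent, hpow]
  · simp only [objf, objExponent, hpow, hcast, Matrix.cons_val_one, Matrix.cons_val_fin_one]
    rw [zpow_add₀ h0.ne']
    norm_cast
  · simp only [objf, objExponent, hpow, hcast, Matrix.cons_val_one, Matrix.cons_val_fin_one]
    rw [zpow_add₀ h0.ne']
    norm_cast
  · simp only [objf, objExponent, hpow, hcast, Matrix.cons_val_one, Matrix.cons_val_fin_one]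
    rw [zpow_sub₀ h0.ne']
    norm_cast

theorem objf_one_le_mul_iff {n : ℕ} {ε δ : ℝ} (h1 : 1 < 1 + δ) (hr : (1 + δ) ^ (2 * n) = 1 + ε)
    (x y : XSpace n) : objf n ε δ x 1 ≤ (1 + ε) * objf n ε δ y 1 ↔
      objExponent n x ≤ 2 * n + objExponent n y := by
  have h0 : 0 < 1 + δ := by linarith
  have hE : 1 + ε = (1 + δ) ^ (2 * n : ℤ) := by
    rw [← hr]
    norm_cast
  rw [objf_one_eq_zpow h0 hr, objf_one_eq_zpow h0 hr, hE, ← zpow_add₀ h0.ne',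
    zpow_le_zpow_iff_right₀ h1]

theorem three_mul_solIndex_le_objf_zero {n : ℕ} (ε δ : ℝ) (x : XSpace n) :
    (3 * solIndex n x : ℝ) ≤ objf n ε δ x 0 := by
  rcases x with _ | i | i | i <;> simp [objf, solIndex]

theorem le_objExponent {n : ℕ} (x : XSpace n) :
    2 * n * (n - solIndex n x : ℤ) - solIndex n x ≤ objExponent n x := by
  rcases x with _ | i | i | i <;> simp [objExponent, solIndex] <;> omega

/-- The solution `x̃ᵏ` is only covered by solutions of index `k`. -/
theorem solIndex_eq_of_covers_xT {n : ℕ} {ε δ : ℝ} (h1 : 1 < 1 + δ)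
    (hr : (1 + δ) ^ (2 * n) = 1 + ε) (i : Fin n) (x : XSpace n)
    (hx0 : objf n ε δ x 0 ≤ objf n ε δ (xT n i) 0)
    (hx1 : objf n ε δ x 1 ≤ (1 + ε) * objf n ε δ (xT n i) 1) :
    solIndex n x = i + 1 := by
  have hle : solIndex n x ≤ i + 1 := by
    have h := (three_mul_solIndex_le_objf_zero ε δ x).trans hx0
    simp only [objf, Matrix.cons_val_zero] at h
    norm_cast at h
    omega
  rw [objf_one_le_mul_iff h1 hr] at hx1
  have h := (le_objExponent x).trans hx1
  simp only [objExponent] at h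
  by_contra hne
  have hlt : (solIndex n x : ℤ) ≤ i := by omega
  nlinarith [mul_nonneg (Int.natCast_nonneg n) (sub_nonneg.2 hlt)]

theorem oneExactApproxSet_x0_xP {n : ℕ} {ε δ : ℝ} (h1 : 1 < 1 + δ)
    (hr : (1 + δ) ^ (2 * n) = 1 + ε) :
    OneExactApproxSet n ε δ ({x0 n} ∪ Finset.univ.image (xP n)) := by
  intro y
  simp only [objf_one_le_mul_iff h1 hr]
  rcases y with _ | i | i | i
  · exact ⟨x0 n, by simp, le_rfl, by simp [objExponent]⟩
  · exact ⟨xP n i, by simp, le_rfl, by simp⟩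
  · obtain ⟨_ | k, hk⟩ := i
    · refine ⟨x0 n, by simp, by simp [objf], ?_⟩
      simp only [objExponent]
      push_cast
      linarith
    · refine ⟨xP n ⟨k, by omega⟩, by simp, ?_, ?_⟩
      · simp only [objf, Matrix.cons_val_zero]
        norm_cast
        omega
      · simp only [objExponent]
        push_cast
        linarith
  · refine ⟨xP n i, by simp, ?_, ?_⟩
    · simp only [objf, Matrix.cons_val_zero]
      norm_cast
      omega
    · simp only [objExponent]
      have := i.isLt
      omega

theorem OneExactApproxSet.succ_le_card {n : ℕ} {ε δ : ℝ} (h1 : 1 < 1 + δ)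
    (hr : (1 + δ) ^ (2 * n) = 1 + ε) {P : Finset (XSpace n)} (hP : OneExactApproxSet n ε δ P) :
    n + 1 ≤ P.card := by
  have hsub : Finset.range (n + 1) ⊆ P.image (solIndex n) := by
    intro k hk
    rw [Finset.mem_range] at hk
    rw [Finset.mem_image]
    rcases k with _ | k
    · obtain ⟨x, hxP, hx0, -⟩ := hP (x0 n)
      refine ⟨x, hxP, ?_⟩
      have h := (three_mul_solIndex_le_objf_zero ε δ x).trans hx0
      simp only [objf, Matrix.cons_val_zero] at h
      norm_cast at h
      omega
    · obtain ⟨x, hxP, hx0, hx1⟩ := hP (xT n ⟨k, by omega⟩)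
      exact ⟨x, hxP, solIndex_eq_of_covers_xT h1 hr _ x hx0 hx1⟩
  simpa using (Finset.card_le_card hsub).trans Finset.card_image_le

theorem stmt_7 (ε : ℝ) (hε : 0 < ε) (n : ℕ) (hn : 1 ≤ n)
    (δ : ℝ) (hδ : δ = (1 + ε) ^ ((1 : ℝ) / (2 * n)) - 1) :
    (1 + δ) ^ (2 * n) = 1 + ε ∧
    -- (i) {x⁰, x¹, …, xⁿ} is a one-exact (1+ε)-approximation set of cardinality n+1
    OneExactApproxSet n ε δ
      ({x0 n} ∪ Finset.univ.image (xP n)) ∧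
    ({x0 n} ∪ Finset.univ.image (xP n)).card = n + 1 ∧
    -- (ii) every one-exact (1+ε)-approximation set has cardinality at least n+1
    (∀ P : Finset (XSpace n), OneExactApproxSet n ε δ P → n + 1 ≤ P.card) ∧
    -- (iii) x⁰ is not strictly dominated by any solution
    (∀ y : XSpace n, ¬ ∀ j, objf n ε δ y j < objf n ε δ (x0 n) j) ∧
    -- (iv) for each i, xⁱ is strictly dominated by x̄ⁱ
    (∀ i : Fin n, ∀ j, objf n ε δ (xB n i) j < objf n ε δ (xP n i) j) := by
  have hr : (1 + δ) ^ (2 * n) = 1 + ε := by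
    have hn0 : (2 * n : ℝ) ≠ 0 := by positivity
    rw [hδ, add_sub_cancel, ← Real.rpow_mul_natCast (by linarith)]
    push_cast
    rw [one_div_mul_cancel hn0, Real.rpow_one]
  have h1 : 1 < 1 + δ := by
    rw [hδ, add_sub_cancel]
    exact Real.one_lt_rpow (by linarith) (by positivity)
  refine ⟨hr, oneExactApproxSet_x0_xP h1 hr, ?_, fun P hP => hP.succ_le_card h1 hr, ?_, ?_⟩
  · rw [Finset.card_union_of_disjoint (by simp), Finset.card_image_of_injective]
    · simp [add_comm]
    · intro i j h
      simpa using h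
  · intro y hy
    have h := hy 0
    rcases y with _ | i | i | i <;> simp only [objf, Matrix.cons_val_zero] at h <;>
      norm_cast at h
  · intro i j
    fin_cases j
    · simp [objf]
    · have h0 : 0 < 1 + δ := by linarith
      simp only [Fin.mk_one, objf_one_eq_zpow h0 hr, zpow_lt_zpow_iff_right₀ h1, objExponent]
      omega
end

section
/- Let X be a nonempty finite set, p ≥ 1 a natural number, and f : X → Fin p → ℝ with f i x > 0 for all i and x. Let ε > 0 and let P ⊆ X be a (1+ε)-approximation set all of whose elements are weakly efficient. Then P is a quasi-1-exact (1+ε)-approximation set. -/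
theorem stmt_8 {X : Type*} [Fintype X] [Nonempty X] (p : ℕ) (hp : 1 ≤ p)
    (f : X → Fin p → ℝ) (hfpos : ∀ (x : X) (i : Fin p), 0 < f x i)
    (ε : ℝ) (hε : 0 < ε)
    (P : Finset X)
    -- P is a (1+ε)-approximation set
    (hP : ∀ x' : X, ∃ x ∈ P, ∀ i, f x i ≤ (1 + ε) * f x' i)
    -- all elements of P are weakly efficient
    (hWE : ∀ x ∈ P, ¬ ∃ x'' : X, ∀ i, f x'' i < f x i) :
    -- P is a quasi-1-exact (1+ε)-approximation set
    ∀ x' : X, ∃ x ∈ P, (∀ i, f x i ≤ (1 + ε) * f x' i) ∧ ∃ i : Fin p, f x i ≤ f x' i := by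
  intro x'
  obtain ⟨x, hxP, hx⟩ := hP x'
  refine ⟨x, hxP, hx, ?_⟩
  by_contra! h
  exact hWE x hxP ⟨x', h⟩
end

section
/- Let X be a nonempty finite set, p ≥ 1 a natural number, f : X → Fin p → ℝ with f i x > 0 for all i and x, and let ε > 0. Then there exists a quasi-1-exact (1+ε)-approximation set whose cardinality equals the minimum cardinality of a (1+ε)-approximation set for (X, f). In particular, the minimum cardinality of a quasi-1-exact (1+ε)-approximation set equals the minimum cardinality of a (1+ε)-approximation set. -/
open Classical in
theorem exists_approx_card_minimal_sum_minimal {X : Type*} [Fintype X] (A : Finset X → Prop)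
    (hA : A Finset.univ) (w : X → ℝ) :
    ∃ P : Finset X, A P ∧ (∀ Q, A Q → P.card ≤ Q.card) ∧
      ∀ Q, A Q → Q.card ≤ P.card → ∑ x ∈ P, w x ≤ ∑ x ∈ Q, w x := by
  obtain ⟨M, hM, hMmin⟩ := Finset.exists_min_image
    (Finset.univ.filter A) Finset.card ⟨Finset.univ, by simpa using hA⟩
  obtain ⟨P, hP, hPmin⟩ := Finset.exists_min_image
    (Finset.univ.filter fun Q => A Q ∧ Q.card ≤ M.card) (fun Q => ∑ x ∈ Q, w x)
    ⟨M, by simpa using hM⟩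
  simp only [Finset.mem_filter, Finset.mem_univ, true_and] at hM hMmin hP hPmin
  exact ⟨P, hP.1, fun Q hQ => hP.2.trans (hMmin Q hQ),
    fun Q hQ hcard => hPmin Q ⟨hQ, hcard.trans hP.2⟩⟩

theorem stmt_9 {X : Type*} [Fintype X] [Nonempty X] (p : ℕ) (hp : 1 ≤ p)
    (f : X → Fin p → ℝ) (hfpos : ∀ (x : X) (i : Fin p), 0 < f x i)
    (ε : ℝ) (hε : 0 < ε) :
    -- there is a quasi-1-exact (1+ε)-approximation set whose cardinality is at most
    -- (hence equal to) the minimum cardinality of a (1+ε)-approximation set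
    ∃ P : Finset X,
      (∀ x' : X, ∃ x ∈ P, (∀ i, f x i ≤ (1 + ε) * f x' i) ∧ ∃ i : Fin p, f x i ≤ f x' i) ∧
      ∀ Q : Finset X, (∀ x' : X, ∃ x ∈ Q, ∀ i, f x i ≤ (1 + ε) * f x' i) →
        P.card ≤ Q.card := by
  classical
  have hself : ∀ x i, f x i ≤ (1 + ε) * f x i := fun x i => by
    nlinarith [mul_pos hε (hfpos x i)]
  obtain ⟨P, hP, hcard, hsum⟩ := exists_approx_card_minimal_sum_minimal
    (fun Q : Finset X => ∀ x' : X, ∃ x ∈ Q, ∀ i, f x i ≤ (1 + ε) * f x' i)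
    (fun x => ⟨x, Finset.mem_univ x, hself x⟩) (fun x => ∑ i, f x i)
  refine ⟨P, fun y => ?_, hcard⟩
  by_contra! hy
  obtain ⟨x, hxP, hx⟩ := hP y
  have hlt := hy x hxP hx
  have hyP : y ∉ P := fun h => lt_irrefl _ (hy y h (hself y) ⟨0, hp⟩)
  have hyE : y ∉ P.erase x := fun h => hyP (Finset.mem_of_mem_erase h)
  have hle := hsum (insert y (P.erase x)) (fun z => ?_) ?_
  · rw [Finset.sum_insert hyE, ← Finset.add_sum_erase P _ hxP] at hle
    have : ∑ i, f y i < ∑ i, f x i :=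
      Finset.sum_lt_sum_of_nonempty ⟨⟨0, hp⟩, Finset.mem_univ _⟩ fun i _ => hlt i
    linarith
  · obtain ⟨u, huP, hu⟩ := hP z
    by_cases hux : u = x
    · subst hux
      exact ⟨y, Finset.mem_insert_self _ _, fun i => (hlt i).le.trans (hu i)⟩
    · exact ⟨u, Finset.mem_insert_of_mem (Finset.mem_erase.2 ⟨hux, huP⟩), hu⟩
  · rw [Finset.card_insert_of_notMem hyE, Finset.card_erase_add_one hxP]
end

section
/- Let ε > 0 and let n ≥ 1 be a natural number. Consider the 3-objective instance with feasible set X = {x⁰, x¹, …, xⁿ} and objective values f(xʲ) = (1 + ((n−j)/n)·ε, 1 + ((n−j)/n)·ε, (1+ε)^(2j+1)) for j = 0,…,n. Then: (i) for any two distinct solutions xʲ and xʲ', xʲ does not quasi-2-exact (1+ε)-dominate xʲ'; hence the only quasi-2-exact (1+ε)-approximation set is X itself, of cardinality n+1; and (ii) the singleton {x⁰} is a (1+ε)-approximation set. In particular, the minimum cardinality of a quasi-2-exact (1+ε)-approximation set exceeds n times the minimum cardinality of a (1+ε)-approximation set. -/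
theorem stmt_10 (ε : ℝ) (hε : 0 < ε) (n : ℕ) (hn : 1 ≤ n)
    (f : Fin (n + 1) → Fin 3 → ℝ)
    (hf : ∀ j : Fin (n + 1), f j =
      ![1 + (((n : ℝ) - (j : ℕ)) / n) * ε,
        1 + (((n : ℝ) - (j : ℕ)) / n) * ε,
        (1 + ε) ^ (2 * (j : ℕ) + 1)]) :
    -- (i) no solution quasi-2-exact (1+ε)-dominates any other solution
    (∀ j j' : Fin (n + 1), j ≠ j' →
      ¬ ((∀ i, f j i ≤ (1 + ε) * f j' i) ∧ 2 ≤ {i : Fin 3 | f j i ≤ f j' i}.ncard)) ∧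
    -- hence the only quasi-2-exact (1+ε)-approximation set is X itself, of cardinality n+1
    (∀ P : Finset (Fin (n + 1)),
      (∀ x' : Fin (n + 1), ∃ x ∈ P,
        (∀ i, f x i ≤ (1 + ε) * f x' i) ∧ 2 ≤ {i : Fin 3 | f x i ≤ f x' i}.ncard) →
      P = Finset.univ ∧ P.card = n + 1) ∧
    -- (ii) the singleton {x⁰} is a (1+ε)-approximation set
    (∀ x' : Fin (n + 1), ∀ i, f 0 i ≤ (1 + ε) * f x' i) ∧
    -- in particular, the minimum cardinality of a quasi-2-exact (1+ε)-approximation set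
    -- exceeds n times the minimum cardinality of a (1+ε)-approximation set
    (∀ P Q : Finset (Fin (n + 1)),
      (∀ x' : Fin (n + 1), ∃ x ∈ P,
        (∀ i, f x i ≤ (1 + ε) * f x' i) ∧ 2 ≤ {i : Fin 3 | f x i ≤ f x' i}.ncard) →
      (∀ x' : Fin (n + 1), ∃ x ∈ Q, ∀ i, f x i ≤ (1 + ε) * f x' i) →
      (∀ Q' : Finset (Fin (n + 1)),
        (∀ x' : Fin (n + 1), ∃ x ∈ Q', ∀ i, f x i ≤ (1 + ε) * f x' i) →
        Q.card ≤ Q'.card) →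
      n * Q.card < P.card) := by
  have hn0 : (0 : ℝ) < n := by exact_mod_cast hn
  have h0 (j) : f j 0 = 1 + (((n : ℝ) - (j : ℕ)) / n) * ε := by simp [hf]
  have h1 (j) : f j 1 = 1 + (((n : ℝ) - (j : ℕ)) / n) * ε := by simp [hf]
  have h2 (j) : f j 2 = (1 + ε) ^ (2 * (j : ℕ) + 1) := by simp [hf]
  have first_lt {j j' : Fin (n + 1)} (h : j < j') : f j' 0 < f j 0 := by
    rw [h0, h0]
    have : ((j : ℕ) : ℝ) < (j' : ℕ) := by exact_mod_cast h
    gcongr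
  have not_dom : ∀ j j' : Fin (n + 1), j ≠ j' →
      ¬ ((∀ i, f j i ≤ (1 + ε) * f j' i) ∧ 2 ≤ {i : Fin 3 | f j i ≤ f j' i}.ncard) := by
    rintro j j' hne ⟨happrox, hcard⟩
    rcases lt_or_gt_of_ne hne with h | h
    · have hsub : {i : Fin 3 | f j i ≤ f j' i} ⊆ {2} := by
        intro i hi
        have hlt := first_lt h
        fin_cases i
        · exact absurd hi hlt.not_ge
        · exact absurd hi (by simpa [h0, h1] using hlt)
        · rfl
      have := Set.ncard_le_ncard hsub
      rw [Set.ncard_singleton] at this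
      omega
    · have h3 := happrox 2
      rw [h2, h2, ← pow_succ', pow_le_pow_iff_right₀ (by linarith)] at h3
      have : (j' : ℕ) < j := h
      omega
  have only_univ : ∀ P : Finset (Fin (n + 1)),
      (∀ x' : Fin (n + 1), ∃ x ∈ P,
        (∀ i, f x i ≤ (1 + ε) * f x' i) ∧ 2 ≤ {i : Fin 3 | f x i ≤ f x' i}.ncard) →
      P = Finset.univ ∧ P.card = n + 1 := by
    intro P hP
    have hPu : P = Finset.univ := by
      refine Finset.eq_univ_of_forall fun x' => ?_
      obtain ⟨x, hx, hdom⟩ := hP x'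
      by_cases hxx : x = x'
      · exact hxx ▸ hx
      · exact absurd hdom (not_dom x x' hxx)
    exact ⟨hPu, by simp [hPu]⟩
  have zero_approx : ∀ x' : Fin (n + 1), ∀ i, f 0 i ≤ (1 + ε) * f x' i := by
    intro x' i
    have key : f 0 0 ≤ (1 + ε) * f x' 0 := by
      have hx : ((x' : ℕ) : ℝ) ≤ n := by exact_mod_cast Nat.lt_succ_iff.mp x'.isLt
      have hnn : 0 ≤ (((n : ℝ) - (x' : ℕ)) / n) * ε :=
        mul_nonneg (div_nonneg (by linarith) hn0.le) hε.le
      have hzero : f 0 0 = 1 + ε := by simp [h0, hn0.ne']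
      rw [hzero, h0]
      exact le_mul_of_one_le_right (by linarith) (by linarith)
    fin_cases i
    · exact key
    · simpa [h0, h1] using key
    · change f 0 2 ≤ (1 + ε) * f x' 2
      rw [h2, h2, ← pow_succ']
      exact pow_le_pow_right₀ (by linarith) (by simp)
  refine ⟨not_dom, only_univ, zero_approx, fun P Q hP _ hQmin => ?_⟩
  have hQ : Q.card ≤ 1 := by
    simpa using hQmin {0} fun x' => ⟨0, Finset.mem_singleton_self 0, zero_approx x'⟩
  rw [(only_univ P hP).2]
  nlinarith
end

section
/- Let X be a nonempty finite set, p ≥ 1 a natural number, f : X → Fin p → ℝ objective functions, and M > 0 a real number with 2^(−M) ≤ f i x ≤ 2^M for all i and all x ∈ X. Let ε > 0 and set D := ⌈(2·M·log 2)/log(1+ε)⌉. Then there exists a quasi-1-exact (1+ε)-approximation set P ⊆ X with |P| ≤ p·D^(p−1). -/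
/-- Grouping points by the diagonal of the grid `{0, …, D - 1} ^ (n + 1)` through their cell,
finitely many points are dominated, cell-wise and in at least one coordinate, by at most
`(n + 1) * D ^ n` of them. -/
theorem exists_card_le_forall_cell_le {X : Type*} [Finite X] {n D : ℕ} (g : X → Fin (n + 1) → ℝ)
    (c : X → Fin (n + 1) → ℕ) (hcD : ∀ x i, c x i < D)
    (hmono : ∀ x y i, g x i ≤ g y i → c x i ≤ c y i) :
    ∃ P : Finset X, P.card ≤ (n + 1) * D ^ n ∧
      ∀ y : X, ∃ x ∈ P, (∀ i, c x i ≤ c y i) ∧ ∃ i, g x i ≤ g y i := by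
  classical
  choose m hm using fun x => Finite.exists_min (c x)
  let key : X → Fin (n + 1) × (Fin n → Fin D) := fun x =>
    (m x, fun j => ⟨c x ((m x).succAbove j) - c x (m x), (Nat.sub_le _ _).trans_lt (hcD _ _)⟩)
  have hrep : ∀ k : Set.range key, ∃ x, key x = k ∧ ∀ y, key y = k → g x k.1.1 ≤ g y k.1.1 := by
    rintro ⟨k, z, hz⟩
    obtain ⟨x, hx, hmin⟩ := Set.exists_min_image {x | key x = k} (fun x => g x k.1)
      (Set.toFinite _) ⟨z, hz⟩
    exact ⟨x, hx, hmin⟩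
  choose r hr hrmin using hrep
  refine ⟨Finset.univ.image r, ?_, fun y => ?_⟩
  · calc (Finset.univ.image r).card ≤ Fintype.card (Set.range key) := Finset.card_image_le
      _ ≤ Fintype.card (Fin (n + 1) × (Fin n → Fin D)) :=
        Fintype.card_le_of_injective _ Subtype.val_injective
      _ = (n + 1) * D ^ n := by simp
  · have hle := hrmin ⟨key y, y, rfl⟩ y rfl
    have hkey := hr ⟨key y, y, rfl⟩
    refine ⟨r ⟨key y, y, rfl⟩, by simp, ?_, m y, hle⟩
    generalize r ⟨key y, y, rfl⟩ = x at hle hkey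
    have hmxy : m x = m y := congrArg Prod.fst hkey
    have hbase : c x (m y) ≤ c y (m y) := hmono _ _ _ hle
    intro i
    rcases Fin.eq_self_or_eq_succAbove (m y) i with rfl | ⟨j, rfl⟩
    · exact hbase
    · have hdiff : c x ((m x).succAbove j) - c x (m x) = c y ((m y).succAbove j) - c y (m y) :=
        congrArg (fun k => (k.2 j : ℕ)) hkey
      have hx := hm x ((m x).succAbove j)
      have hy := hm y ((m y).succAbove j)
      rw [hmxy] at hdiff hx
      omega

theorem stmt_16 {X : Type*} [Fintype X] [Nonempty X] (p : ℕ) (hp : 1 ≤ p)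
    (f : X → Fin p → ℝ) (hfpos : ∀ (x : X) (i : Fin p), 0 < f x i)
    (M : ℝ) (hM : 0 < M)
    (hbound : ∀ (x : X) (i : Fin p), (2 : ℝ) ^ (-M) ≤ f x i ∧ f x i ≤ (2 : ℝ) ^ M)
    (ε : ℝ) (hε : 0 < ε)
    (D : ℕ) (hD : D = ⌈(2 * M * Real.log 2) / Real.log (1 + ε)⌉₊) :
    ∃ P : Finset X, P.card ≤ p * D ^ (p - 1) ∧
      ∀ x' : X, ∃ x ∈ P, (∀ i, f x i ≤ (1 + ε) * f x' i) ∧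
        ∃ i : Fin p, f x i ≤ f x' i := by
  obtain ⟨n, rfl⟩ : ∃ n, p = n + 1 := ⟨p - 1, by omega⟩
  have hL : 0 < Real.log (1 + ε) := Real.log_pos (by linarith)
  have hDpos : 0 < D := by
    rw [hD, Nat.ceil_pos]
    have := Real.log_pos (one_lt_two (α := ℝ))
    positivity
  have hDle : 2 * M * Real.log 2 / Real.log (1 + ε) ≤ D := hD ▸ Nat.le_ceil _
  let g : X → Fin (n + 1) → ℝ := fun x i =>
    (Real.log (f x i) + M * Real.log 2) / Real.log (1 + ε)
  have hg0 : ∀ x i, 0 ≤ g x i := fun x i => by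
    have h := Real.log_le_log (by positivity) (hbound x i).1
    rw [Real.log_rpow two_pos] at h
    exact div_nonneg (by linarith) hL.le
  have hgD : ∀ x i, g x i ≤ D := fun x i => by
    have h := Real.log_le_log (hfpos x i) (hbound x i).2
    rw [Real.log_rpow two_pos] at h
    refine le_trans ?_ hDle
    dsimp only [g]
    gcongr
    linarith
  have hg_mono : ∀ x y i, f x i ≤ f y i → g x i ≤ g y i := fun x y i h => by
    have := Real.log_le_log (hfpos x i) h
    dsimp only [g]
    gcongr
  let c : X → Fin (n + 1) → ℕ := fun x i => min (D - 1) ⌊g x i⌋₊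
  have hc_le : ∀ x i, (c x i : ℝ) ≤ g x i := fun x i =>
    le_trans (by exact_mod_cast min_le_right _ _) (Nat.floor_le (hg0 x i))
  have hle_c : ∀ x i, g x i ≤ c x i + 1 := fun x i => by
    rcases min_choice (D - 1) ⌊g x i⌋₊ with h | h
    · have h1 : c x i + 1 = D := by dsimp only [c]; omega
      have h2 : (c x i : ℝ) + 1 = D := by exact_mod_cast h1
      exact h2 ▸ hgD x i
    · have h1 : c x i = ⌊g x i⌋₊ := h
      rw [h1]
      exact (Nat.lt_floor_add_one _).le
  obtain ⟨P, hcard, hP⟩ := exists_card_le_forall_cell_le f c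
    (D := D) (fun x i => (min_le_left _ _).trans_lt (by omega))
    (fun x y i h => min_le_min_left _ (Nat.floor_mono (hg_mono x y i h)))
  refine ⟨P, hcard, fun y => ?_⟩
  obtain ⟨x, hxP, hx, hex⟩ := hP y
  refine ⟨x, hxP, fun i => ?_, hex⟩
  have hcxy : (c x i : ℝ) ≤ c y i := by exact_mod_cast hx i
  have hgxy : g x i ≤ g y i + 1 := by linarith [hle_c x i, hc_le y i]
  have hpos := hfpos y i
  rw [← Real.log_le_log_iff (hfpos x i) (by positivity), Real.log_mul (by positivity) hpos.ne']
  dsimp only [g] at hgxy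
  rw [div_add_one hL.ne', div_le_div_iff_of_pos_right hL] at hgxy
  linarith
end
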